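/- The graph T1 is not 3-colourable and is not word-representable. -/

import Mathlib

/-- Two distinct letters `x` and `y` alternate in the word `w` if, after deleting all
letters other than `x` and `y` from `w`, no two consecutive letters of the resulting
word are equal (i.e. it reads `xyxy...` or `yxyx...`). -/
def Alternates {V : Type*} [DecidableEq V] (w : List V) (x y : V) : Prop :=
  List.Chain' (· ≠ ·) (w.filter fun z => z = x ∨ z = y)

/-- A finite simple graph `G = (V, E)` is word-representable if there is a word over the
alphabet `V` in which every element of `V` occurs at least once and such that, for all
distinct `x, y ∈ V`, the letters `x` and `y` alternate in the word iff `{x, y} ∈ E`. -/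
def WordRepresentable {V : Type*} [DecidableEq V] (G : SimpleGraph V) : Prop :=
  ∃ w : List V, (∀ v : V, v ∈ w) ∧
    ∀ x y : V, x ≠ y → (G.Adj x y ↔ Alternates w x y)

/-- The simple graph on `V` whose edges are (the unordered versions of) the pairs
occurring in the list `l`. -/
def graphOfList {V : Type*} (l : List (V × V)) : SimpleGraph V :=
  SimpleGraph.fromRel fun a b => (a, b) ∈ l

def edgesT1 : List ((Fin 3 × Fin 3) × (Fin 3 × Fin 3)) :=
  [
    ((0, 0), (1, 0)), ((0, 0), (0, 1)), ((0, 1), (1, 1)), ((0, 1), (0, 2)), ((0, 2), (1, 2)),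
    ((1, 0), (2, 0)), ((1, 0), (1, 1)), ((1, 1), (2, 1)), ((1, 1), (1, 2)), ((1, 2), (2, 2)),
    ((2, 0), (2, 1)), ((2, 1), (2, 2)), ((0, 0), (1, 1)), ((0, 1), (1, 2)), ((1, 0), (2, 1)),
    ((1, 2), (2, 1))]

/-- The graph `T1` from the paper. -/
def graphT1 : SimpleGraph (Fin 3 × Fin 3) := graphOfList edgesT1

theorem chainAux {V : Type*} [DecidableEq V] (w : List V) : ∀ x y : V, x ≠ y →
    (List.IsChain (· ≠ ·) (x :: w.filter fun z => z = x ∨ z = y) ↔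
      ∀ p, p <+: w → (-1 ≤ (p.count x : ℤ) - p.count y ∧ (p.count x : ℤ) - p.count y ≤ 0)) := by
  induction w with
  | nil =>
    intro x y h
    simp
  | cons a w ih =>
    intro x y h
    by_cases hx : a = x
    · subst hx
      simp only [List.filter_cons, true_or, decide_true, if_true]
      constructor
      · intro hc
        simp at hc
      · intro hp
        have := (hp [a] (by simp)).2
        simp [List.count_cons, h] at this
    · by_cases hy : a = y
      · subst hy
        have e : (w.filter fun z => z = x ∨ z = a) = (w.filter fun z => z = a ∨ z = x) := by
          congr 1; ext z; simp [or_comm]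
        simp only [List.filter_cons, or_true, decide_true, if_true]
        rw [List.isChain_cons_cons, e, ih a x hx]
        constructor
        · rintro ⟨-, hp⟩ p hpp
          rcases p with _ | ⟨b, p⟩
          · simp
          · rw [List.cons_prefix_cons] at hpp
            obtain ⟨rfl, hpp⟩ := hpp
            have := hp p hpp
            simp [List.count_cons, hx]
            omega
        · intro hp
          refine ⟨h, fun p hpp => ?_⟩
          have := hp (a :: p) (by simpa [List.cons_prefix_cons] using hpp)
          simp [List.count_cons, hx] at this
          omega
      · simp only [List.filter_cons, hx, hy, or_false, decide_false]
        simp only [Bool.false_eq_true, if_false]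
        rw [ih x y h]
        constructor
        · intro hp p hpp
          rcases p with _ | ⟨b, p⟩
          · simp
          · rw [List.cons_prefix_cons] at hpp
            obtain ⟨rfl, hpp⟩ := hpp
            have := hp p hpp
            simpa [List.count_cons, hx, hy] using this
        · intro hp p hpp
          have := hp (a :: p) (by simpa [List.cons_prefix_cons] using hpp)
          simpa [List.count_cons, hx, hy] using this

theorem alt_iff {V : Type*} [DecidableEq V] (w : List V) (x y : V) (h : x ≠ y) :
    Alternates w x y ↔ ∃ m : ℤ, ∀ p, p <+: w →
      (m ≤ (p.count x : ℤ) - p.count y ∧ (p.count x : ℤ) - p.count y ≤ m + 1) := by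
  have h1 := chainAux w x y h
  have h2 := chainAux w y x h.symm
  have e : (w.filter fun z => z = y ∨ z = x) = (w.filter fun z => z = x ∨ z = y) := by
    congr 1; ext z; simp [or_comm]
  rw [e] at h2
  have h3 : Alternates w x y ↔
      (List.IsChain (· ≠ ·) (x :: w.filter fun z => z = x ∨ z = y) ∨
       List.IsChain (· ≠ ·) (y :: w.filter fun z => z = x ∨ z = y)) := by
    unfold Alternates
    have hm : ∀ z ∈ (w.filter fun z => z = x ∨ z = y), z = x ∨ z = y := by
      intro z hz
      simpa using (List.mem_filter.1 hz).2
    generalize (w.filter fun z => z = x ∨ z = y) = l at hm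
    change List.IsChain _ _ ↔ _
    rcases l with _ | ⟨b, l⟩
    · simp
    · skip
      rw [List.isChain_cons_cons, List.isChain_cons_cons]
      rcases hm b (by simp) with rfl | rfl
      · simp [h.symm]
      · simp [h]
  rw [h3, h1, h2]
  constructor
  · rintro (hp | hp)
    · exact ⟨-1, fun p hpp => by have := hp p hpp; omega⟩
    · exact ⟨0, fun p hpp => by have := hp p hpp; omega⟩
  · rintro ⟨m, hp⟩
    have h0 := hp [] (by simp)
    simp at h0
    obtain hm | hm : m = -1 ∨ m = 0 := by omega
    · left; intro p hpp; have := hp p hpp; omega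
    · right; intro p hpp; have := hp p hpp; omega

theorem nbhd_comparability {V : Type*} [DecidableEq V] (w : List V) (c : V) :
    ∃ R : V → V → Prop, (∀ x y z, R x y → R y z → R x z) ∧
      ∀ x y, x ≠ y → x ≠ c → y ≠ c → Alternates w x c → Alternates w y c →
        (Alternates w x y ↔ (R x y ∨ R y x)) := by
  classical
  have : ∀ x : V, ∃ m : ℤ, x ≠ c → Alternates w x c → ∀ p, p <+: w →
      (m ≤ (p.count x : ℤ) - p.count c ∧ (p.count x : ℤ) - p.count c ≤ m + 1) := by
    intro x
    by_cases h : x ≠ c ∧ Alternates w x c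
    · obtain ⟨m, hm⟩ := (alt_iff w x c h.1).1 h.2
      exact ⟨m, fun _ _ => hm⟩
    · exact ⟨0, fun a b => absurd ⟨a, b⟩ h⟩
  choose m hm using this
  refine ⟨fun x y => ∀ p, p <+: w → (p.count x : ℤ) - m x ≤ p.count y - m y, ?_, ?_⟩
  · intro x y z h1 h2 p hp
    exact (h1 p hp).trans (h2 p hp)
  · intro x y hxy hx hy ax ay
    have bx := hm x hx ax
    have byy := hm y hy ay
    rw [alt_iff w x y hxy]
    constructor
    · rintro ⟨k, hk⟩
      by_cases hc : 0 ≤ k + m y - m x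
      · right; intro p hp; have := hk p hp; omega
      · left; intro p hp; have := hk p hp; omega
    · rintro (h | h)
      · refine ⟨m x - m y - 1, fun p hp => ?_⟩
        have := h p hp; have := bx p hp; have := byy p hp; omega
      · refine ⟨m x - m y, fun p hp => ?_⟩
        have := h p hp; have := bx p hp; have := byy p hp; omega

instance : DecidableRel graphT1.Adj := fun a b => by
  unfold graphT1 graphOfList
  rw [SimpleGraph.fromRel_adj]
  infer_instance

/-- The graph `T1` is not 3-colourable and is not word-representable. -/
theorem graphT1_not_colorable_not_wordRepresentable :
    ¬ graphT1.Colorable 3 ∧ ¬ WordRepresentable graphT1 := by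
  constructor
  · rintro ⟨C⟩
    have h1 := C.valid (show graphT1.Adj (1,1) (0,0) by decide)
    have h2 := C.valid (show graphT1.Adj (1,1) (1,0) by decide)
    have h3 := C.valid (show graphT1.Adj (1,1) (2,1) by decide)
    have h4 := C.valid (show graphT1.Adj (1,1) (1,2) by decide)
    have h5 := C.valid (show graphT1.Adj (1,1) (0,1) by decide)
    have k1 := C.valid (show graphT1.Adj (0,0) (1,0) by decide)
    have k2 := C.valid (show graphT1.Adj (1,0) (2,1) by decide)
    have k3 := C.valid (show graphT1.Adj (2,1) (1,2) by decide)
    have k4 := C.valid (show graphT1.Adj (1,2) (0,1) by decide)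
    have k5 := C.valid (show graphT1.Adj (0,1) (0,0) by decide)
    omega
  · rintro ⟨w, -, hw⟩
    obtain ⟨R, ht, hR⟩ := nbhd_comparability w (1,1)
    have key : ∀ x y, x ≠ y → graphT1.Adj x (1,1) → graphT1.Adj y (1,1) →
        (graphT1.Adj x y ↔ (R x y ∨ R y x)) := by
      intro x y hxy hx hy
      rw [hw x y hxy]
      exact hR x y hxy hx.ne hy.ne ((hw _ _ hx.ne).1 hx) ((hw _ _ hy.ne).1 hy)
    have e1 := (key (0,0) (1,0) (by decide) (by decide) (by decide)).1 (by decide)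
    have e2 := (key (1,0) (2,1) (by decide) (by decide) (by decide)).1 (by decide)
    have e3 := (key (2,1) (1,2) (by decide) (by decide) (by decide)).1 (by decide)
    have e4 := (key (1,2) (0,1) (by decide) (by decide) (by decide)).1 (by decide)
    have e5 := (key (0,1) (0,0) (by decide) (by decide) (by decide)).1 (by decide)
    have n1 := (key (0,0) (2,1) (by decide) (by decide) (by decide)).not.1 (by decide)
    have n2 := (key (1,0) (1,2) (by decide) (by decide) (by decide)).not.1 (by decide)
    have n3 := (key (2,1) (0,1) (by decide) (by decide) (by decide)).not.1 (by decide)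
    have n4 := (key (1,2) (0,0) (by decide) (by decide) (by decide)).not.1 (by decide)
    have n5 := (key (0,1) (1,0) (by decide) (by decide) (by decide)).not.1 (by decide)
    clear key hR hw
    grind
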